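/- There is no Rota–Baxter operator R of nonzero weight λ on the matrix algebra Mₙ(F) (char F = 0) satisfying R + R* + λ·id = 0, where R* is the trace-form adjoint. -/

import Mathlib

open Polynomial in
lemma aux_trace_zero {F : Type*} [Field F] [CharZero F] {n : ℕ}
    (k : Matrix (Fin n) (Fin n) F) (h : ∀ m : ℕ, (k ^ (m + 2)).trace = 0) : k.trace = 0 := by
  obtain ⟨q, hq, hnd⟩ := exists_eq_pow_rootMultiplicity_mul_and_not_dvd k.charpoly
    (Matrix.charpoly_monic k).ne_zero 0
  generalize k.charpoly.rootMultiplicity 0 = a at hq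
  rw [C_0, sub_zero] at hq hnd
  have hcop : IsCoprime ((X : F[X]) ^ (a + 2)) q :=
    ((Polynomial.irreducible_X.coprime_iff_not_dvd).2 hnd).pow_left
  obtain ⟨u, v, huv⟩ := hcop
  have hCH : aeval k k.charpoly = 0 := Matrix.aeval_self_charpoly k
  set e := aeval k (u * X ^ (a + 2)) with he
  have hide : IsIdempotentElem e := by
    have h1 : (u * X ^ (a+2)) * (u * X ^ (a+2)) = u * X ^ (a+2) - k.charpoly * (u * v * X ^ 2) := by
      rw [hq]
      linear_combination (u * X ^ (a+2)) * huv
    rw [IsIdempotentElem, he, ← map_mul, h1, map_sub, map_mul _ k.charpoly, hCH]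
    simp
  have htr : e.trace = 0 := by
    rw [he, map_mul, aeval_eq_sum_range, Finset.sum_mul, Matrix.trace_sum]
    refine Finset.sum_eq_zero fun i _ => ?_
    rw [map_pow, aeval_X, smul_mul_assoc, ← pow_add, Matrix.trace_smul, ← add_assoc, h, smul_zero]
  have he0 : e = 0 := by
    have hi : IsIdempotentElem (Matrix.toLin' e) := by
      rw [IsIdempotentElem, Module.End.mul_eq_comp, ← Matrix.toLin'_mul, hide.eq]
    have := (LinearMap.IsIdempotentElem.trace_eq_zero_iff hi).1 (by rw [Matrix.trace_toLin'_eq, htr])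
    simpa using this
  have hn : k ^ a = 0 := by
    have h1 : (X : F[X]) ^ a = X ^ a * (u * X ^ (a+2)) + k.charpoly * v := by
      conv_rhs => rw [hq]
      linear_combination (- X ^ a) * huv
    have h2 := congrArg (aeval k) h1
    rw [map_add, map_mul _ (X ^ a), map_mul _ k.charpoly, hCH, ← he, he0] at h2
    simpa using h2
  exact (Matrix.isNilpotent_trace_of_isNilpotent ⟨a, hn⟩).eq_zero

lemma aux_one_mem {F : Type*} [Field F] [CharZero F] {n : ℕ} (c : F) (hc : c ≠ 0)
    (T U : Matrix (Fin n) (Fin n) F →ₗ[F] Matrix (Fin n) (Fin n) F)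
    (hadj : ∀ x y, (T x * y).trace = -(x * U y).trace)
    (hU : ∀ x, U x = T x + c • x)
    (hmul : ∀ x y, T x = 0 → T y = 0 → T (x * y) = 0) : ∃ x, U x = 1 := by
  by_contra hno
  have hnot : (1 : Matrix (Fin n) (Fin n) F) ∉ LinearMap.range U := by
    rintro ⟨x, hx⟩; exact hno ⟨x, hx⟩
  obtain ⟨f, hf1, hf⟩ := Submodule.exists_le_ker_of_notMem hnot
  let k : Matrix (Fin n) (Fin n) F := Matrix.of fun i j => f (Matrix.single j i 1)
  have hk : ∀ y, f y = (k * y).trace := by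
    intro y
    conv_lhs => rw [Matrix.matrix_eq_sum_single y]
    simp only [map_sum, Matrix.trace, Matrix.diag, Matrix.mul_apply]
    rw [Finset.sum_comm]
    refine Finset.sum_congr rfl fun i _ => Finset.sum_congr rfl fun j _ => ?_
    have : Matrix.single j i (y j i) = y j i • Matrix.single j i (1 : F) := by simp
    rw [this, map_smul, smul_eq_mul, mul_comm]
    rfl
  have hTk : T k = 0 := by
    refine Matrix.ext_iff_trace_mul_right.2 fun y => ?_
    have : f (U y) = 0 := hf ⟨y, rfl⟩
    rw [hadj, ← hk, this]; simp
  have hpow : ∀ m : ℕ, T (k ^ (m + 1)) = 0 := by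
    intro m
    induction m with
    | zero => simpa using hTk
    | succ m ih => rw [pow_succ]; exact hmul _ _ ih hTk
  apply hf1
  rw [hk, mul_one]
  refine aux_trace_zero k fun m => ?_
  have h1 := hadj k (k ^ (m+1))
  rw [hTk, hU, hpow, zero_add, zero_mul, Matrix.trace_zero, mul_smul_comm, Matrix.trace_smul,
    ← pow_succ', smul_eq_mul] at h1
  have h2 : c * (k ^ (m + 1 + 1)).trace = 0 := by linear_combination h1
  exact (mul_eq_zero.1 h2).resolve_left hc


/-- There is no Rota–Baxter operator `R` of nonzero weight `lam` on `Mₙ(F)`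
(char F = 0, n ≥ 1) satisfying `R + R* + lam·id = 0`, where `R*` is the
trace-form adjoint. -/
theorem no_skew_rb_nonzero_weight_on_matrices {F : Type*} [Field F] [CharZero F]
    {n : ℕ} (hn : 0 < n) (lam : F) (hlam : lam ≠ 0)
    (R Rs : Matrix (Fin n) (Fin n) F →ₗ[F] Matrix (Fin n) (Fin n) F)
    (hRB : ∀ x y, R x * R y = R (R x * y + x * R y + lam • (x * y)))
    (hadj : ∀ x y, (R x * y).trace = (x * Rs y).trace)
    (hskew : ∀ x, R x + Rs x + lam • x = 0) :
    False := by
  have hRs : ∀ x, Rs x = -(R x + lam • x) := fun x => by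
    have := hskew x
    rw [eq_neg_iff_add_eq_zero, ← this]; abel
  let P : Matrix (Fin n) (Fin n) F →ₗ[F] Matrix (Fin n) (Fin n) F := R + lam • LinearMap.id
  have hP : ∀ x, P x = R x + lam • x := fun x => rfl
  have hRP : ∀ x y, (R x * y).trace = -(x * P y).trace := fun x y => by
    rw [hadj, hRs, hP, mul_neg, Matrix.trace_neg]
  have hPR : ∀ x y, (P x * y).trace = -(x * R y).trace := fun x y => by
    rw [Matrix.trace_mul_comm x, hRP, Matrix.trace_mul_comm y, neg_neg]
  have hPB : ∀ x y, P x * P y = P (R x * y + x * R y + lam • (x * y)) := fun x y => by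
    simp only [hP, ← hRB]
    simp only [add_mul, mul_add, smul_add, smul_mul_assoc, mul_smul_comm]
    abel
  obtain ⟨x, hx⟩ := aux_one_mem lam hlam R P hRP hP (fun x y hx hy => by
    have := hRB x y
    rw [hx, hy] at this
    simpa [hlam] using this.symm)
  obtain ⟨y, hy⟩ := aux_one_mem (-lam) (neg_ne_zero.2 hlam) P R hPR
    (fun x => by rw [hP]; simp) (fun x y hx hy => by
    have := hPB x y
    have h1 : R x = -(lam • x) := by rw [eq_neg_iff_add_eq_zero, ← hP, hx]
    have h2 : R y = -(lam • y) := by rw [eq_neg_iff_add_eq_zero, ← hP, hy]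
    rw [hx, hy, h1, h2] at this
    simpa [hlam] using this.symm)
  have h1 := hPB x y
  have h2 := hRB x y
  generalize R x * y + x * R y + lam • (x * y) = z at h1 h2
  rw [hx, one_mul] at h1
  rw [hy, mul_one] at h2
  have h3 : P (z - y) = 0 := by rw [map_sub, h1, sub_self]
  have h4 : R (z - y) = R x - 1 := by rw [map_sub, hy, h2]
  have h5 : R x - 1 = -(lam • (z - y)) := by rw [← h4, eq_neg_iff_add_eq_zero, ← hP, h3]
  have h6 : lam • x = lam • (z - y) := by
    have h7 : R x + lam • x = 1 := by rw [← hP, hx]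
    rw [← neg_inj, ← h5, ← h7]; abel
  have h8 : x = z - y := smul_right_injective _ hlam h6
  rw [← h8, hx] at h3
  have := congrFun (congrFun h3 ⟨0, hn⟩) ⟨0, hn⟩
  simp at this
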